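/- Let k ≥ 1 and let W1,…,Wk, V1,…,Vk, V̄1,…,V̄k, F, G be jointly distributed finite-valued random variables such that: I((W1,…,Wk); (F,G)) = 0; and for each i ∈ {1,…,k}: Wi is uniform over a 2-element set, H(Vi, V̄i | Wi, F) = 0, I(Vi; V̄i | Wi) = 0, and each of the triples (F,G,Vi) and (F,G,V̄i) is, after relabeling by injections of the supports into {0,1}, uniformly distributed over {(0,0,0),(0,1,0),(1,0,0),(1,0,1)}. Then there exist injections relabeling the supports of F and of each Wi, Vi, V̄i into {0,1} under which, almost surely, Vi = (1−Wi)·F and V̄i = Wi·F for all i ∈ {1,…,k}. -/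

import Mathlib

namespace CIPaper

/-- A bundled probability space. -/
structure ProbSpace where
  carrier : Type
  [inst : MeasurableSpace carrier]
  μ : MeasureTheory.Measure carrier
  [isProb : MeasureTheory.IsProbabilityMeasure μ]

attribute [instance] ProbSpace.inst ProbSpace.isProb

/-- A bundled finite measurable alphabet, used as value space of auxiliary random variables. -/
structure FinAlphabet where
  carrier : Type
  [fin : Fintype carrier]
  [ms : MeasurableSpace carrier]
  [msc : MeasurableSingletonClass carrier]

attribute [instance] FinAlphabet.fin FinAlphabet.ms FinAlphabet.msc

open MeasureTheory ProbabilityTheory Real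

variable {Ω : Type*} [MeasurableSpace Ω] {S T U : Type*}

/-- P(X = x). -/
noncomputable def pr (μ : Measure Ω) (X : Ω → S) (x : S) : ℝ :=
  (μ (X ⁻¹' {x})).toReal

/-- Shannon entropy (base 2) of a finite-valued random variable. -/
noncomputable def ent (μ : Measure Ω) [Fintype S] (X : Ω → S) : ℝ :=
  (∑ x, Real.negMulLog (pr μ X x)) / Real.log 2

/-- Conditional entropy H(X|Y). -/
noncomputable def condEnt (μ : Measure Ω) [Fintype S] [Fintype T]
    (X : Ω → S) (Y : Ω → T) : ℝ :=
  ent μ (fun ω => (X ω, Y ω)) - ent μ Y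

/-- Mutual information I(X;Y). -/
noncomputable def mi (μ : Measure Ω) [Fintype S] [Fintype T]
    (X : Ω → S) (Y : Ω → T) : ℝ :=
  ent μ X + ent μ Y - ent μ (fun ω => (X ω, Y ω))

/-- Conditional mutual information I(X;Y|Z). -/
noncomputable def cmi (μ : Measure Ω) [Fintype S] [Fintype T] [Fintype U]
    (X : Ω → S) (Y : Ω → T) (Z : Ω → U) : ℝ :=
  ent μ (fun ω => (X ω, Z ω)) + ent μ (fun ω => (Y ω, Z ω))
    - ent μ (fun ω => (X ω, (Y ω, Z ω))) - ent μ Z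

/-- The support of a random variable: values of positive probability. -/
def support (μ : Measure Ω) (X : Ω → S) : Set S := {x | 0 < pr μ X x}

/-- X is uniformly distributed over its support. -/
def IsUniform (μ : Measure Ω) (X : Ω → S) : Prop :=
  ∀ x ∈ support μ X, ∀ y ∈ support μ X, pr μ X x = pr μ X y

/-- X is uniformly distributed over a support of size n. -/
def UniformOn (μ : Measure Ω) (X : Ω → S) (n : ℕ) : Prop :=
  IsUniform μ X ∧ (support μ X).ncard = n

/-- The TRIPLE predicate: pairwise independence plus each variable a function of the
other two. -/
def TRIPLE (μ : Measure Ω) [Fintype S] [Fintype T] [Fintype U]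
    (X : Ω → S) (Y : Ω → T) (Z : Ω → U) : Prop :=
  condEnt μ X (fun ω => (Y ω, Z ω)) = 0 ∧ condEnt μ Y (fun ω => (X ω, Z ω)) = 0 ∧
    condEnt μ Z (fun ω => (X ω, Y ω)) = 0 ∧
    mi μ X Y = 0 ∧ mi μ X Z = 0 ∧ mi μ Y Z = 0

end CIPaper

namespace CIPaper

open MeasureTheory ProbabilityTheory Real

/-- The triple (F,G₁,G₂) is, after injective relabeling of the supports into {0,1},
uniformly distributed over {(0,0,0),(0,1,0),(1,0,0),(1,0,1)}. -/
def FlipDist {Ω : Type*} [MeasurableSpace Ω] (μ : Measure Ω) {S T U : Type*}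
    (F : Ω → S) (G₁ : Ω → T) (G₂ : Ω → U) : Prop :=
  ∃ (f : S → Fin 2) (g₁ : T → Fin 2) (g₂ : U → Fin 2),
    Set.InjOn f (support μ F) ∧ Set.InjOn g₁ (support μ G₁) ∧ Set.InjOn g₂ (support μ G₂) ∧
    ∀ a b c : Fin 2,
      pr μ (fun ω => (f (F ω), g₁ (G₁ ω), g₂ (G₂ ω))) (a, b, c) =
        if (a, b, c) ∈ ({((0:Fin 2), (0:Fin 2), (0:Fin 2)), (0, 1, 0), (1, 0, 0), (1, 0, 1)} :
            Finset (Fin 2 × Fin 2 × Fin 2)) then (4:ℝ)⁻¹ else 0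

section Gibbs

lemma sub_le_mul_log_sub {p q : ℝ} (hp : 0 ≤ p) (hq : 0 ≤ q) (hpq : q = 0 → p = 0) :
    p - q ≤ p * (log p - log q) := by
  rcases hp.eq_or_lt with rfl | hp
  · simpa using hq
  have hq' : 0 < q := hq.lt_of_ne fun h => hp.ne' (hpq h.symm)
  have h := log_le_sub_one_of_pos (div_pos hq' hp)
  rw [log_div hq'.ne' hp.ne'] at h
  have h2 := mul_le_mul_of_nonneg_left h hp.le
  have h3 : p * (q / p - 1) = q - p := by field_simp
  linarith

lemma eq_of_mul_log_sub_eq {p q : ℝ} (hp : 0 ≤ p) (hq : 0 ≤ q) (hpq : q = 0 → p = 0)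
    (h : p * (log p - log q) = p - q) : p = q := by
  rcases hp.eq_or_lt with rfl | hp
  · simpa [eq_comm] using h
  have hq' : 0 < q := hq.lt_of_ne fun h => hp.ne' (hpq h.symm)
  by_contra hne
  have hlt := log_lt_sub_one_of_pos (div_pos hq' hp)
    fun h1 => hne ((div_eq_one_iff_eq hp.ne').1 h1).symm
  rw [log_div hq'.ne' hp.ne'] at hlt
  have h2 := mul_lt_mul_of_pos_left hlt hp
  have h3 : p * (q / p - 1) = q - p := by field_simp
  linarith

/-- The equality case of Gibbs' inequality. -/
lemma eq_of_sum_mul_log_sub_eq_zero {ι : Type*} [Fintype ι] {p q : ι → ℝ}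
    (hp : ∀ i, 0 ≤ p i) (hq : ∀ i, 0 ≤ q i) (hpq : ∀ i, q i = 0 → p i = 0)
    (hsum : ∑ i, q i ≤ ∑ i, p i) (h : ∑ i, p i * (log (p i) - log (q i)) = 0) (i : ι) :
    p i = q i := by
  have hnn : ∀ j ∈ Finset.univ, 0 ≤ p j * (log (p j) - log (q j)) - (p j - q j) := fun j _ =>
    sub_nonneg.2 (sub_le_mul_log_sub (hp j) (hq j) (hpq j))
  have h0 : ∑ j, (p j * (log (p j) - log (q j)) - (p j - q j)) = 0 := by
    refine le_antisymm ?_ (Finset.sum_nonneg hnn)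
    rw [Finset.sum_sub_distrib, Finset.sum_sub_distrib]
    linarith
  exact eq_of_mul_log_sub_eq (hp i) (hq i) (hpq i)
    (sub_eq_zero.1 ((Finset.sum_eq_zero_iff_of_nonneg hnn).1 h0 i (Finset.mem_univ i)))

end Gibbs

section Law

variable {Ω : Type*} [MeasurableSpace Ω] {μ : Measure Ω} {S T U : Type*}

lemma pr_nonneg (X : Ω → S) (x : S) : 0 ≤ pr μ X x := ENNReal.toReal_nonneg

lemma pr_congr_ae {X : Ω → S} {Y : Ω → T} {x : S} {y : T}
    (h : ∀ᵐ ω ∂μ, X ω = x ↔ Y ω = y) : pr μ X x = pr μ Y y := by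
  unfold pr
  congr 1
  apply measure_congr
  filter_upwards [h] with ω hω
  exact propext hω

lemma pr_prod_of_indepFun [MeasurableSpace S] [MeasurableSingletonClass S]
    [MeasurableSpace T] [MeasurableSingletonClass T] {X : Ω → S} {Y : Ω → T}
    (h : IndepFun X Y μ) (x : S) (y : T) :
    pr μ (fun ω => (X ω, Y ω)) (x, y) = pr μ X x * pr μ Y y := by
  unfold pr
  rw [← ENNReal.toReal_mul, ← h.measure_inter_preimage_eq_mul _ _ (measurableSet_singleton x)
    (measurableSet_singleton y), ← Set.mk_preimage_prod, Set.singleton_prod_singleton]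

variable [IsProbabilityMeasure μ]

lemma pr_comp_le (X : Ω → S) (g : S → T) (x : S) :
    pr μ X x ≤ pr μ (fun ω => g (X ω)) (g x) :=
  ENNReal.toReal_mono (measure_ne_top _ _) (measure_mono fun _ hω => congrArg g hω)

lemma ae_mem_support [Fintype S] {X : Ω → S} : ∀ᵐ ω ∂μ, X ω ∈ support μ X := by
  have h : ∀ᵐ ω ∂μ, ∀ x, ¬ 0 < pr μ X x → X ω ≠ x := by
    rw [ae_all_iff]
    intro x
    by_cases hx : 0 < pr μ X x
    · exact ae_of_all _ fun ω h => absurd hx h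
    · have h0 : μ (X ⁻¹' {x}) = 0 := by
        have := le_antisymm (not_lt.1 hx) (pr_nonneg X x)
        exact ((ENNReal.toReal_eq_zero_iff _).1 this).resolve_right (measure_ne_top _ _)
      filter_upwards [measure_eq_zero_iff_ae_notMem.1 h0] with ω hω _ h
      exact hω h
  filter_upwards [h] with ω hω
  by_contra hn
  exact hω _ hn rfl

variable [Fintype S] [MeasurableSpace S] [MeasurableSingletonClass S]
  [Fintype T] [MeasurableSpace T] [MeasurableSingletonClass T]
  [Fintype U] [MeasurableSpace U] [MeasurableSingletonClass U]

lemma pr_comp {R : Type*} [DecidableEq R] {X : Ω → S} (hX : Measurable X) (g : S → R) (b : R) :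
    pr μ (fun ω => g (X ω)) b = ∑ x, if g x = b then pr μ X x else 0 := by
  classical
  have h : (fun ω => g (X ω)) ⁻¹' {b} =
      ⋃ x ∈ Finset.univ.filter (fun x => g x = b), X ⁻¹' {x} := by
    ext ω; simp
  unfold pr
  rw [h, measure_biUnion_finset, ENNReal.toReal_sum, Finset.sum_filter]
  · intro x _; exact measure_ne_top _ _
  · intro x _ y _ hxy
    exact Disjoint.preimage _ (by simpa using hxy)
  · intro x _; exact hX (measurableSet_singleton x)

lemma pr_fst {X : Ω → S} {Y : Ω → T} (hX : Measurable X) (hY : Measurable Y) (x : S) :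
    pr μ X x = ∑ y, pr μ (fun ω => (X ω, Y ω)) (x, y) := by
  classical
  rw [pr_comp (hX.prodMk hY) Prod.fst x, Fintype.sum_prod_type]
  rw [Finset.sum_eq_single x] <;> simp +contextual

lemma pr_snd {X : Ω → S} {Y : Ω → T} (hX : Measurable X) (hY : Measurable Y) (y : T) :
    pr μ Y y = ∑ x, pr μ (fun ω => (X ω, Y ω)) (x, y) := by
  classical
  rw [pr_comp (hX.prodMk hY) Prod.snd y, Fintype.sum_prod_type]
  simp

lemma pr_eq_of_condEnt_eq_zero {X : Ω → S} {Y : Ω → T} (hX : Measurable X) (hY : Measurable Y)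
    (h : condEnt μ X Y = 0) (x : S) (y : T) :
    pr μ (fun ω => (X ω, Y ω)) (x, y) = 0 ∨ pr μ (fun ω => (X ω, Y ω)) (x, y) = pr μ Y y := by
  set p := pr μ (fun ω => (X ω, Y ω)) with hp
  have hle : ∀ z, p z ≤ pr μ Y z.2 := fun z => pr_comp_le (fun ω => (X ω, Y ω)) Prod.snd z
  have hnn : ∀ z ∈ Finset.univ, 0 ≤ p z * (log (pr μ Y z.2) - log (p z)) := by
    intro z _
    rcases (pr_nonneg _ z : 0 ≤ p z).eq_or_lt with h0 | h0
    · rw [hp, ← h0]; simp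
    · exact mul_nonneg h0.le (sub_nonneg.2 (log_le_log h0 (hle z)))
  have hsum : ∑ z, p z * (log (pr μ Y z.2) - log (p z)) = 0 := by
    have hlog : log 2 ≠ 0 := (log_pos one_lt_two).ne'
    have hY' : ∑ y, negMulLog (pr μ Y y) = ∑ z : S × T, -(p z * log (pr μ Y z.2)) := by
      rw [Fintype.sum_prod_type_right]
      refine Finset.sum_congr rfl fun y _ => ?_
      simp only [Finset.sum_neg_distrib, ← Finset.sum_mul, negMulLog, neg_mul]
      rw [pr_snd hX hY]
    unfold condEnt ent at h
    rw [← sub_div, div_eq_zero_iff, or_iff_left hlog, hY', ← Finset.sum_sub_distrib] at h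
    rw [← h]
    refine Finset.sum_congr rfl fun z _ => ?_
    rw [negMulLog]; ring
  have hz := (Finset.sum_eq_zero_iff_of_nonneg hnn).1 hsum (x, y) (Finset.mem_univ _)
  rcases (pr_nonneg _ (x, y) : 0 ≤ p (x, y)).eq_or_lt with h0 | h0
  · exact Or.inl h0.symm
  · right
    rcases mul_eq_zero.1 hz with h1 | h1
    · exact absurd h1 h0.ne'
    · exact (log_injOn_pos (h0.trans_le (hle _)) h0 (sub_eq_zero.1 h1)).symm

lemma pr_mul_pr_of_cmi_eq_zero {X : Ω → S} {Y : Ω → T} {Z : Ω → U} (hX : Measurable X)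
    (hY : Measurable Y) (hZ : Measurable Z) (h : cmi μ X Y Z = 0) (x : S) (y : T) (z : U) :
    pr μ (fun ω => (X ω, (Y ω, Z ω))) (x, (y, z)) * pr μ Z z =
      pr μ (fun ω => (X ω, Z ω)) (x, z) * pr μ (fun ω => (Y ω, Z ω)) (y, z) := by
  set p := pr μ (fun ω => (X ω, (Y ω, Z ω))) with hp
  set a := pr μ (fun ω => (X ω, Z ω)) with ha
  set b := pr μ (fun ω => (Y ω, Z ω)) with hb
  set c := pr μ Z with hc
  have ha' : ∀ x z, a (x, z) = ∑ y, p (x, (y, z)) := by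
    intro x z
    have h1 := pr_fst (μ := μ) (hX.prodMk hZ) hY (x, z)
    rw [ha, h1]
    exact Finset.sum_congr rfl fun y _ => pr_congr_ae (ae_of_all _ fun _ => by
      simp only [Prod.mk.injEq]; tauto)
  have hb' : ∀ y z, b (y, z) = ∑ x, p (x, (y, z)) := fun y z => pr_snd hX (hY.prodMk hZ) (y, z)
  have hca : ∀ z, c z = ∑ x, a (x, z) := fun z => pr_snd hX hZ z
  have hcb : ∀ z, c z = ∑ y, b (y, z) := fun z => pr_snd hY hZ z
  have hpa : ∀ x y z, p (x, (y, z)) ≤ a (x, z) := fun x y z =>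
    pr_comp_le (fun ω => (X ω, (Y ω, Z ω))) (fun t => (t.1, t.2.2)) (x, (y, z))
  have hpb : ∀ x y z, p (x, (y, z)) ≤ b (y, z) := fun x y z =>
    pr_comp_le (fun ω => (X ω, (Y ω, Z ω))) (fun t => t.2) (x, (y, z))
  have hbc : ∀ y z, b (y, z) ≤ c z := fun y z =>
    pr_comp_le (fun ω => (Y ω, Z ω)) (fun t => t.2) (y, z)
  have hp0 : ∀ t, 0 ≤ p t := pr_nonneg _
  have ha0 : ∀ t, 0 ≤ a t := pr_nonneg _
  have hb0 : ∀ t, 0 ≤ b t := pr_nonneg _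
  have hc0 : ∀ t, 0 ≤ c t := pr_nonneg _
  set q : S × T × U → ℝ := fun t => a (t.1, t.2.2) * b t.2 / c t.2.2 with hq
  have hpos : ∀ t, p t ≠ 0 → 0 < a (t.1, t.2.2) ∧ 0 < b t.2 ∧ 0 < c t.2.2 := by
    rintro ⟨x, y, z⟩ ht
    have h1 := (hp0 (x, y, z)).lt_of_ne' ht
    exact ⟨h1.trans_le (hpa x y z), h1.trans_le (hpb x y z),
      (h1.trans_le (hpb x y z)).trans_le (hbc y z)⟩
  have hlog : log 2 ≠ 0 := (log_pos one_lt_two).ne'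
  have key : ∀ t, p t = q t := by
    refine eq_of_sum_mul_log_sub_eq_zero hp0
      (fun t => div_nonneg (mul_nonneg (ha0 _) (hb0 _)) (hc0 _)) ?_ ?_ ?_
    · intro t ht
      by_contra hne
      obtain ⟨h1, h2, h3⟩ := hpos t hne
      exact (div_pos (mul_pos h1 h2) h3).ne' ht
    · have hqs : ∑ t, q t = ∑ z, c z := by
        simp only [hq, Fintype.sum_prod_type]
        have : ∀ x, ∑ y, ∑ z, a (x, z) * b (y, z) / c z = ∑ z, a (x, z) * c z / c z := by
          intro x
          rw [Finset.sum_comm]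
          refine Finset.sum_congr rfl fun z _ => ?_
          rw [← Finset.sum_div, ← Finset.mul_sum, ← hcb]
        simp only [this]
        rw [Finset.sum_comm]
        refine Finset.sum_congr rfl fun z _ => ?_
        rw [← Finset.sum_div, ← Finset.sum_mul, ← hca, mul_self_div_self]
      have hps : ∑ t, p t = ∑ z, c z := by
        rw [Fintype.sum_prod_type_right, Fintype.sum_prod_type_right]
        refine Finset.sum_congr rfl fun z _ => ?_
        rw [hcb]
        exact Finset.sum_congr rfl fun y _ => (hb' y z).symm
      rw [hqs, hps]
    · have hA : ∑ t, negMulLog (a t) = ∑ t : S × T × U, -(p t * log (a (t.1, t.2.2))) := by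
        simp only [Fintype.sum_prod_type]
        refine Finset.sum_congr rfl fun x _ => ?_
        rw [Finset.sum_comm]
        refine Finset.sum_congr rfl fun z _ => ?_
        rw [Finset.sum_neg_distrib, ← Finset.sum_mul, ← ha', negMulLog, neg_mul]
      have hB : ∑ t, negMulLog (b t) = ∑ t : S × T × U, -(p t * log (b t.2)) := by
        refine Eq.trans ?_ (Fintype.sum_prod_type_right _).symm
        refine Finset.sum_congr rfl fun t _ => ?_
        simp only [Finset.sum_neg_distrib, ← Finset.sum_mul, ← hb', negMulLog, neg_mul]
      have hC : ∑ t, negMulLog (c t) = ∑ t : S × T × U, -(p t * log (c t.2.2)) := by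
        rw [Fintype.sum_prod_type_right, Fintype.sum_prod_type_right]
        refine Finset.sum_congr rfl fun z _ => ?_
        simp only [Finset.sum_neg_distrib, ← Finset.sum_mul, ← hb', ← hcb, negMulLog, neg_mul]
      unfold cmi ent at h
      rw [← add_div, ← sub_div, ← sub_div, div_eq_zero_iff, or_iff_left hlog, hA, hB, hC,
        ← Finset.sum_add_distrib, ← Finset.sum_sub_distrib, ← Finset.sum_sub_distrib] at h
      rw [← h]
      refine Finset.sum_congr rfl fun t _ => ?_
      by_cases ht : p t = 0
      · simp [ht, ← hp]
      · obtain ⟨h1, h2, h3⟩ := hpos t ht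
        rw [hq, log_div (mul_pos h1 h2).ne' h3.ne', log_mul h1.ne' h2.ne', negMulLog, ← hp]
        ring
  rw [key]
  rcases (hc0 z).eq_or_lt with h0 | h0
  · have : b (y, z) = 0 := le_antisymm (h0 ▸ hbc y z) (hb0 _)
    simp [this, ← h0]
  · simp only [hq]
    field_simp

lemma pr_prod_of_mi_eq_zero {X : Ω → S} {Y : Ω → T} (hX : Measurable X) (hY : Measurable Y)
    (h : mi μ X Y = 0) (x : S) (y : T) :
    pr μ (fun ω => (X ω, Y ω)) (x, y) = pr μ X x * pr μ Y y := by
  have hone : pr μ (fun _ : Ω => ()) () = 1 := by simp [pr]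
  have hX' : ∀ x, pr μ (fun ω => (X ω, ())) (x, ()) = pr μ X x := fun x =>
    pr_congr_ae (ae_of_all _ fun _ => by simp)
  have hY' : ∀ y, pr μ (fun ω => (Y ω, ())) (y, ()) = pr μ Y y := fun y =>
    pr_congr_ae (ae_of_all _ fun _ => by simp)
  have hXY : ∀ x y, pr μ (fun ω => (X ω, (Y ω, ()))) (x, (y, ())) =
      pr μ (fun ω => (X ω, Y ω)) (x, y) := fun x y =>
    pr_congr_ae (ae_of_all _ fun _ => by simp)
  have hc : cmi μ X Y (fun _ => ()) = 0 := by
    rw [← h]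
    simp [cmi, mi, ent, Fintype.sum_prod_type, hX', hY', hXY, hone]
  simpa [hX', hY', hXY, hone] using
    pr_mul_pr_of_cmi_eq_zero hX hY measurable_const hc x y ()

lemma sum_pr_eq_one {X : Ω → S} (hX : Measurable X) : ∑ x, pr μ X x = 1 := by
  have h := pr_comp (μ := μ) hX (fun _ => ()) ()
  simpa [pr] using h.symm

lemma indepFun_of_mi_eq_zero {X : Ω → S} {Y : Ω → T} (hX : Measurable X) (hY : Measurable Y)
    (h : mi μ X Y = 0) : IndepFun X Y μ := by
  rw [indepFun_iff_map_prod_eq_prod_map_map hX.aemeasurable hY.aemeasurable]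
  refine Measure.ext_of_singleton fun ⟨x, y⟩ => ?_
  have h1 := pr_prod_of_mi_eq_zero hX hY h x y
  unfold pr at h1
  rw [← ENNReal.toReal_mul, ENNReal.toReal_eq_toReal_iff' (measure_ne_top _ _)
    (ENNReal.mul_ne_top (measure_ne_top _ _) (measure_ne_top _ _))] at h1
  rw [Measure.map_apply (hX.prodMk hY) (measurableSet_singleton _), h1,
    ← Set.singleton_prod_singleton, Measure.prod_prod,
    Measure.map_apply hX (measurableSet_singleton _),
    Measure.map_apply hY (measurableSet_singleton _)]

end Law

section Labels

variable {Ω : Type*} [MeasurableSpace Ω] {μ : Measure Ω} {S T : Type*}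

/-- `f` labels the support of `X` injectively and `s` picks the value carrying each label. -/
structure Labels (μ : Measure Ω) (X : Ω → S) (f : S → Fin 2) (s : Fin 2 → S) : Prop where
  injOn : Set.InjOn f (support μ X)
  mem (a : Fin 2) : s a ∈ support μ X
  apply_eq (a : Fin 2) : f (s a) = a

lemma Labels.apply_section {X : Ω → S} {f : S → Fin 2} {s : Fin 2 → S} (h : Labels μ X f s)
    {x : S} (hx : x ∈ support μ X) : s (f x) = x :=
  h.injOn (h.mem _) hx (h.apply_eq _)

variable [IsProbabilityMeasure μ]

lemma Labels.ae_eq_iff [Fintype S] {X : Ω → S} {f : S → Fin 2} {s : Fin 2 → S}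
    (h : Labels μ X f s) : ∀ᵐ ω ∂μ, ∀ a, f (X ω) = a ↔ X ω = s a := by
  filter_upwards [ae_mem_support (X := X)] with ω hω a
  refine ⟨?_, fun h1 => h1 ▸ h.apply_eq a⟩
  rintro rfl
  exact (h.apply_section hω).symm

lemma exists_labels [Fintype S] {X : Ω → S} {f : S → Fin 2} (hf : Set.InjOn f (support μ X))
    (h : ∀ a, pr μ (fun ω => f (X ω)) a ≠ 0) : ∃ s, Labels μ X f s := by
  have hex : ∀ a, ∃ x ∈ support μ X, f x = a := by
    intro a
    by_contra! hn
    refine h a ?_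
    have h0 : μ ((fun ω => f (X ω)) ⁻¹' {a}) = 0 := by
      rw [measure_eq_zero_iff_ae_notMem]
      filter_upwards [ae_mem_support (X := X)] with ω hω h1
      exact hn _ hω h1
    simp [pr, h0]
  choose s hs using hex
  exact ⟨s, hf, fun a => (hs a).1, fun a => (hs a).2⟩

lemma Labels.pr_prod [Fintype S] [Fintype T] {X : Ω → S} {Y : Ω → T} {f : S → Fin 2}
    {g : T → Fin 2} {s : Fin 2 → S} {t : Fin 2 → T} (hf : Labels μ X f s) (hg : Labels μ Y g t) (a b : Fin 2) :
    pr μ (fun ω => (f (X ω), g (Y ω))) (a, b) = pr μ (fun ω => (X ω, Y ω)) (s a, t b) := by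
  refine pr_congr_ae ?_
  filter_upwards [hf.ae_eq_iff, hg.ae_eq_iff] with ω h1 h2
  simp only [Prod.mk.injEq, h1, h2]

end Labels

section Flip

/-- The law of `(F, V)` when `F` is a fair bit and `V` is `0` for `F = 0` and a fair bit for
`F = 1`. -/
noncomputable def gatedLaw (a c : Fin 2) : ℝ := if a = 0 then (if c = 0 then 2⁻¹ else 0) else 4⁻¹

/-- A law of `((V, Vb), (W, F))` on bits with `(V, Vb)` determined by the uniform pair `(W, F)`,
with `V` and `Vb` gated by `F` and conditionally independent given `W`. -/
lemma gated_atoms {p : (Fin 2 × Fin 2) × (Fin 2 × Fin 2) → ℝ} (hp0 : ∀ x, 0 ≤ p x)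
    (hWF : ∀ w f, p ((0, 0), (w, f)) + p ((0, 1), (w, f)) + p ((1, 0), (w, f)) +
      p ((1, 1), (w, f)) = 4⁻¹)
    (hV0 : ∀ b w, p ((1, b), (w, 0)) = 0) (hVb0 : ∀ a w, p ((a, 1), (w, 0)) = 0)
    (hV1 : p ((1, 0), (0, 1)) + p ((1, 1), (0, 1)) + p ((1, 0), (1, 1)) + p ((1, 1), (1, 1)) = 4⁻¹)
    (hVb1 : p ((0, 1), (0, 1)) + p ((1, 1), (0, 1)) + p ((0, 1), (1, 1)) +
      p ((1, 1), (1, 1)) = 4⁻¹)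
    (hdep : ∀ x, p x = 0 ∨ p x = 4⁻¹)
    (hind : ∀ w, p ((1, 1), (w, 1)) * 2⁻¹ =
      (p ((1, 0), (w, 1)) + p ((1, 1), (w, 1))) * (p ((0, 1), (w, 1)) + p ((1, 1), (w, 1)))) :
    (∀ x, 0 < p x → x.1.1 = (1 - x.2.1) * x.2.2 ∧ x.1.2 = x.2.1 * x.2.2) ∨
      (∀ x, 0 < p x → x.1.1 = x.2.1 * x.2.2 ∧ x.1.2 = (1 - x.2.1) * x.2.2) := by
  have h11 : ∀ w, p ((1, 1), (w, 1)) = 0 := by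
    intro w
    refine (hdep _).resolve_right fun h => ?_
    have h1 := hWF w 1
    have h2 : p ((1, 0), (w, 1)) = 0 := by
      linarith [hp0 ((0, 0), (w, 1)), hp0 ((0, 1), (w, 1)), hp0 ((1, 0), (w, 1))]
    have h3 : p ((0, 1), (w, 1)) = 0 := by
      linarith [hp0 ((0, 0), (w, 1)), hp0 ((0, 1), (w, 1)), hp0 ((1, 0), (w, 1))]
    have h4 := hind w
    rw [h, h2, h3] at h4
    norm_num at h4
  have hw0 := hWF 0 1
  have hw1 := hWF 1 1
  have hn := fun a b w => hp0 ((a, b), (w, 1))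
  rw [h11, h11] at hV1 hVb1
  rw [h11] at hw0 hw1
  rcases hdep ((1, 0), (0, 1)) with h | h
  · right
    have h1 : p ((1, 0), (1, 1)) = 4⁻¹ := by linarith
    have h2 : p ((0, 1), (1, 1)) = 0 := by linarith [hn 0 0 1, hn 0 1 1]
    have h3 : p ((0, 0), (1, 1)) = 0 := by linarith [hn 0 0 1, hn 0 1 1]
    have h4 : p ((0, 1), (0, 1)) = 4⁻¹ := by linarith
    have h5 : p ((0, 0), (0, 1)) = 0 := by linarith
    simp [Prod.forall, Fin.forall_fin_two, hV0, hVb0, h11, h, h2, h3, h5]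
  · left
    have h1 : p ((1, 0), (1, 1)) = 0 := by linarith
    have h2 : p ((0, 1), (0, 1)) = 0 := by linarith [hn 0 0 0, hn 0 1 0]
    have h3 : p ((0, 0), (0, 1)) = 0 := by linarith [hn 0 0 0, hn 0 1 0]
    have h4 : p ((0, 1), (1, 1)) = 4⁻¹ := by linarith
    have h5 : p ((0, 0), (1, 1)) = 0 := by linarith
    simp [Prod.forall, Fin.forall_fin_two, hV0, hVb0, h11, h1, h2, h3, h5]

variable {Ω : Type*} [MeasurableSpace Ω] {μ : Measure Ω} [IsProbabilityMeasure μ]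

/-- The binary form of the statement for a single triple `(W, V, Vb)`. -/
lemma ae_eq_mul_or_ae_eq_mul {W F V Vb : Ω → Fin 2} (hW : Measurable W) (hF : Measurable F)
    (hV : Measurable V) (hVb : Measurable Vb)
    (hWF : ∀ a b, pr μ (fun ω => (W ω, F ω)) (a, b) = 4⁻¹)
    (hFV : ∀ a c, pr μ (fun ω => (F ω, V ω)) (a, c) = gatedLaw a c)
    (hFVb : ∀ a c, pr μ (fun ω => (F ω, Vb ω)) (a, c) = gatedLaw a c)
    (hdep : ∀ x, pr μ (fun ω => ((V ω, Vb ω), (W ω, F ω))) x = 0 ∨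
      pr μ (fun ω => ((V ω, Vb ω), (W ω, F ω))) x = 4⁻¹)
    (hind : ∀ w, pr μ (fun ω => (V ω, (Vb ω, W ω))) (1, (1, w)) * pr μ W w =
      pr μ (fun ω => (V ω, W ω)) (1, w) * pr μ (fun ω => (Vb ω, W ω)) (1, w)) :
    (∀ᵐ ω ∂μ, V ω = (1 - W ω) * F ω ∧ Vb ω = W ω * F ω) ∨
      (∀ᵐ ω ∂μ, V ω = W ω * F ω ∧ Vb ω = (1 - W ω) * F ω) := by
  let X : Ω → (Fin 2 × Fin 2) × (Fin 2 × Fin 2) := fun ω => ((V ω, Vb ω), (W ω, F ω))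
  have hX : Measurable X := (hV.prodMk hVb).prodMk (hW.prodMk hF)
  have hp0 : ∀ x, 0 ≤ pr μ X x := pr_nonneg X
  have hsupp := ae_mem_support (μ := μ) (X := X)
  have eWF a b : pr μ (fun ω => (W ω, F ω)) (a, b) = ∑ x, if x.2 = (a, b) then pr μ X x else 0 :=
    pr_comp hX (fun x => x.2) (a, b)
  have eFV a c : pr μ (fun ω => (F ω, V ω)) (a, c) =
      ∑ x, if (x.2.2, x.1.1) = (a, c) then pr μ X x else 0 :=
    pr_comp hX (fun x => (x.2.2, x.1.1)) (a, c)
  have eFVb a c : pr μ (fun ω => (F ω, Vb ω)) (a, c) =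
      ∑ x, if (x.2.2, x.1.2) = (a, c) then pr μ X x else 0 :=
    pr_comp hX (fun x => (x.2.2, x.1.2)) (a, c)
  have eVW w : pr μ (fun ω => (V ω, W ω)) (1, w) =
      ∑ x, if (x.1.1, x.2.1) = (1, w) then pr μ X x else 0 :=
    pr_comp hX (fun x => (x.1.1, x.2.1)) (1, w)
  have eVbW w : pr μ (fun ω => (Vb ω, W ω)) (1, w) =
      ∑ x, if (x.1.2, x.2.1) = (1, w) then pr μ X x else 0 :=
    pr_comp hX (fun x => (x.1.2, x.2.1)) (1, w)
  have eVVbW w : pr μ (fun ω => (V ω, (Vb ω, W ω))) (1, (1, w)) =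
      ∑ x, if (x.1.1, (x.1.2, x.2.1)) = (1, (1, w)) then pr μ X x else 0 :=
    pr_comp hX (fun x => (x.1.1, (x.1.2, x.2.1))) (1, (1, w))
  have eW w : pr μ W w = 2⁻¹ := by
    rw [pr_fst hW hF, Fin.sum_univ_two, hWF, hWF]; norm_num
  replace hWF a b := (eWF a b).symm.trans (hWF a b)
  replace hFV a c := (eFV a c).symm.trans (hFV a c)
  replace hFVb a c := (eFVb a c).symm.trans (hFVb a c)
  simp only [eVW, eVbW, eVVbW, eW] at hind
  replace hdep : ∀ x, pr μ X x = 0 ∨ pr μ X x = 4⁻¹ := hdep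
  have main := gated_atoms (p := pr μ X) hp0
  clear eWF eFV eFVb eVW eVbW eVVbW eW
  have hV0 : ∀ b w, pr μ X ((1, b), (w, 0)) = 0 := by
    have h := hFV 0 1
    simp [Fintype.sum_prod_type, Fin.sum_univ_two, gatedLaw] at h
    intro b w
    fin_cases b <;> fin_cases w <;> dsimp <;>
    linarith [hp0 ((1, 0), (0, 0)), hp0 ((1, 1), (0, 0)), hp0 ((1, 0), (1, 0)),
      hp0 ((1, 1), (1, 0))]
  have hVb0 : ∀ a w, pr μ X ((a, 1), (w, 0)) = 0 := by
    have h := hFVb 0 1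
    simp [Fintype.sum_prod_type, Fin.sum_univ_two, gatedLaw] at h
    intro b w
    fin_cases b <;> fin_cases w <;> dsimp <;>
    linarith [hp0 ((0, 1), (0, 0)), hp0 ((1, 1), (0, 0)), hp0 ((0, 1), (1, 0)),
      hp0 ((1, 1), (1, 0))]
  refine (main ?_ hV0 hVb0 ?_ ?_ hdep ?_).imp ?_ ?_
  · intro w f
    have h := hWF w f
    simp only [Fintype.sum_prod_type_right, Prod.mk.injEq] at h
    fin_cases w <;> fin_cases f <;> simp [Fin.sum_univ_two] at h ⊢ <;> linarith
  · have h := hFV 1 1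
    simp [Fintype.sum_prod_type, Fin.sum_univ_two, gatedLaw] at h
    linarith
  · have h := hFVb 1 1
    simp [Fintype.sum_prod_type, Fin.sum_univ_two, gatedLaw] at h
    linarith
  · intro w
    have h := hind w
    fin_cases w <;>
    simp [Fintype.sum_prod_type, Fin.sum_univ_two, hV0, hVb0] at h ⊢ <;> linarith
  · intro h
    filter_upwards [hsupp] with ω hω using h _ hω
  · intro h
    filter_upwards [hsupp] with ω hω using h _ hω

variable {S T U : Type*} [Fintype S] [Fintype T] [Fintype U]

/-- The law of `(F, G)` under `FlipDist`. -/
noncomputable def driverLaw (a b : Fin 2) : ℝ := if a = 0 then 4⁻¹ else if b = 0 then 2⁻¹ else 0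

/-- The labelling of `F` is determined by the law of `(F, G)`. -/
lemma Labels.ae_eq_of_driverLaw {F : Ω → S} {G : Ω → T} {f f' : S → Fin 2} {s s' : Fin 2 → S}
    {g g' : T → Fin 2} {t t' : Fin 2 → T} (hf : Labels μ F f s) (hg : Labels μ G g t)
    (h : ∀ a b, pr μ (fun ω => (f (F ω), g (G ω))) (a, b) = driverLaw a b)
    (hf' : Labels μ F f' s') (hg' : Labels μ G g' t')
    (h' : ∀ a b, pr μ (fun ω => (f' (F ω), g' (G ω))) (a, b) = driverLaw a b) :
    ∀ᵐ ω ∂μ, f' (F ω) = f (F ω) := by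
  have h1 : f (s' 1) = 1 := by
    have e1 := h' 1 0
    have e2 := h (f (s' 1)) (g (t' 0))
    rw [hf'.pr_prod hg'] at e1
    rw [hf.pr_prod hg, hf.apply_section (hf'.mem _), hg.apply_section (hg'.mem _), e1] at e2
    by_contra hne
    have h0 : f (s' 1) = 0 := by omega
    rw [h0] at e2
    norm_num [driverLaw] at e2
  have h0 : f (s' 0) = 0 := by
    have hne : f (s' 0) ≠ f (s' 1) := fun hc => by
      have h2 := congrArg f' (hf.injOn (hf'.mem 0) (hf'.mem 1) hc)
      rw [hf'.apply_eq, hf'.apply_eq] at h2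
      exact zero_ne_one h2
    omega
  filter_upwards [ae_mem_support (μ := μ) (X := F)] with ω hω
  have h2 := hf'.apply_section hω
  obtain h3 | h3 : f' (F ω) = 0 ∨ f' (F ω) = 1 := by omega
  · rw [h3] at h2 ⊢; rw [← h2, h0]
  · rw [h3] at h2 ⊢; rw [← h2, h1]

variable [MeasurableSpace S] [MeasurableSingletonClass S]
  [MeasurableSpace T] [MeasurableSingletonClass T]
  [MeasurableSpace U] [MeasurableSingletonClass U]

lemma FlipDist.exists_labels {F : Ω → S} {G : Ω → T} {V : Ω → U} (hF : Measurable F)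
    (hG : Measurable G) (hV : Measurable V) (h : FlipDist μ F G V) :
    ∃ (f : S → Fin 2) (s : Fin 2 → S) (g : T → Fin 2) (t : Fin 2 → T) (v : U → Fin 2)
      (u : Fin 2 → U), Labels μ F f s ∧ Labels μ G g t ∧ Labels μ V v u ∧
      (∀ a b, pr μ (fun ω => (f (F ω), g (G ω))) (a, b) = driverLaw a b) ∧
      (∀ a c, pr μ (fun ω => (f (F ω), v (V ω))) (a, c) = gatedLaw a c) ∧
      ∀ a, pr μ (fun ω => f (F ω)) a = 2⁻¹ := by
  obtain ⟨f, g, v, hf, hg, hv, h⟩ := h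
  let X : Ω → Fin 2 × Fin 2 × Fin 2 := fun ω => (f (F ω), g (G ω), v (V ω))
  have hX : Measurable X := ((measurable_of_countable f).comp hF).prodMk
    (((measurable_of_countable g).comp hG).prodMk ((measurable_of_countable v).comp hV))
  have h' : ∀ a b c, pr μ X (a, b, c) = _ := h
  have eF a : pr μ (fun ω => f (F ω)) a = 2⁻¹ := by
    rw [show pr μ (fun ω => f (F ω)) a = _ from pr_comp hX (fun x => x.1) a]
    fin_cases a <;> simp [Fintype.sum_prod_type, Fin.sum_univ_two, h'] <;> norm_num
  have eG : ∀ b, pr μ (fun ω => g (G ω)) b ≠ 0 := by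
    intro b
    rw [show pr μ (fun ω => g (G ω)) b = _ from pr_comp hX (fun x => x.2.1) b]
    fin_cases b <;> simp [Fintype.sum_prod_type, Fin.sum_univ_two, h'] <;> norm_num
  have eV : ∀ c, pr μ (fun ω => v (V ω)) c ≠ 0 := by
    intro c
    rw [show pr μ (fun ω => v (V ω)) c = _ from pr_comp hX (fun x => x.2.2) c]
    fin_cases c <;> simp [Fintype.sum_prod_type, Fin.sum_univ_two, h'] <;> norm_num
  obtain ⟨s, hs⟩ := CIPaper.exists_labels hf fun a => by rw [eF]; norm_num
  obtain ⟨t, ht⟩ := CIPaper.exists_labels hg eG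
  obtain ⟨u, hu⟩ := CIPaper.exists_labels hv eV
  refine ⟨f, s, g, t, v, u, hs, ht, hu, fun a b => ?_, fun a c => ?_, eF⟩
  · rw [show pr μ (fun ω => (f (F ω), g (G ω))) (a, b) = _ from
      pr_comp hX (fun x => (x.1, x.2.1)) (a, b)]
    fin_cases a <;> fin_cases b <;>
    simp [Fintype.sum_prod_type, Fin.sum_univ_two, h', driverLaw] <;> norm_num
  · rw [show pr μ (fun ω => (f (F ω), v (V ω))) (a, c) = _ from
      pr_comp hX (fun x => (x.1, x.2.2)) (a, c)]
    fin_cases a <;> fin_cases c <;>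
    simp [Fintype.sum_prod_type, Fin.sum_univ_two, h', gatedLaw] <;> norm_num

lemma UniformOn.exists_labels {X : Ω → S}
    (hX : Measurable X) (h : UniformOn μ X 2) :
    ∃ f s, Labels μ X f s ∧ ∀ a, pr μ X (s a) = 2⁻¹ := by
  classical
  obtain ⟨hu, hc⟩ := h
  obtain ⟨x, y, hxy, hs⟩ := Set.ncard_eq_two.1 hc
  have hx : x ∈ support μ X := by simp [hs]
  have hy : y ∈ support μ X := by simp [hs]
  have hl : Labels μ X (fun z => if z = y then 1 else 0) ![x, y] := by
    refine ⟨?_, ?_, ?_⟩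
    · rw [hs]
      rintro a (rfl | rfl) b (rfl | rfl) <;> simp [hxy]
    · simp [Fin.forall_fin_two, hx, hy]
    · simp [Fin.forall_fin_two, hxy]
  refine ⟨_, _, hl, ?_⟩
  have hsum : pr μ X x + pr μ X y = 1 := by
    rw [← sum_pr_eq_one (μ := μ) hX, ← Finset.sum_pair hxy]
    refine Finset.sum_subset (Finset.subset_univ _) fun z _ hz => ?_
    by_contra hne
    have : z ∈ support μ X := (pr_nonneg X z).lt_of_ne' hne
    rw [hs] at this
    simp_all
  have := hu x hx y hy
  simp only [Fin.forall_fin_two, Matrix.cons_val_zero, Matrix.cons_val_one]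
  constructor <;> linarith

lemma Labels.exists_eq_mul {R : Type*} [Fintype R] [MeasurableSpace R] [MeasurableSingletonClass R]
    {W : Ω → R} {F : Ω → S} {V : Ω → T} {Vb : Ω → U} (hWm : Measurable W) (hFm : Measurable F)
    (hVm : Measurable V) (hVbm : Measurable Vb) {f : S → Fin 2} {s : Fin 2 → S} {v : T → Fin 2}
    {t : Fin 2 → T} {vb : U → Fin 2} {u : Fin 2 → U} (hf : Labels μ F f s) (hv : Labels μ V v t)
    (hvb : Labels μ Vb vb u) (hF : ∀ a, pr μ (fun ω => f (F ω)) a = 2⁻¹)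
    (hFV : ∀ a c, pr μ (fun ω => (f (F ω), v (V ω))) (a, c) = gatedLaw a c)
    (hFVb : ∀ a c, pr μ (fun ω => (f (F ω), vb (Vb ω))) (a, c) = gatedLaw a c)
    (hWF : IndepFun W F μ) (hWunif : UniformOn μ W 2)
    (hdep : condEnt μ (fun ω => (V ω, Vb ω)) (fun ω => (W ω, F ω)) = 0)
    (hindep : cmi μ V Vb W = 0) :
    ∃ w : R → Fin 2, Set.InjOn w (support μ W) ∧
      ∀ᵐ ω ∂μ, v (V ω) = (1 - w (W ω)) * f (F ω) ∧ vb (Vb ω) = w (W ω) * f (F ω) := by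
  obtain ⟨w, r, hw, hr⟩ := hWunif.exists_labels hWm
  have hF' a : pr μ F (s a) = 2⁻¹ := by
    rw [← hF a]
    refine (pr_congr_ae ?_).symm
    filter_upwards [hf.ae_eq_iff] with ω h using h a
  have hWF' a b : pr μ (fun ω => (W ω, F ω)) (r a, s b) = 4⁻¹ := by
    rw [pr_prod_of_indepFun hWF, hr, hF']; norm_num
  have hdep' x : pr μ (fun ω => ((v (V ω), vb (Vb ω)), (w (W ω), f (F ω)))) x = 0 ∨
      pr μ (fun ω => ((v (V ω), vb (Vb ω)), (w (W ω), f (F ω)))) x = 4⁻¹ := by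
    obtain ⟨⟨a, b⟩, c, d⟩ := x
    have h1 := pr_eq_of_condEnt_eq_zero (hVm.prodMk hVbm) (hWm.prodMk hFm) hdep (t a, u b) (r c, s d)
    rw [hWF'] at h1
    convert h1 using 2 <;>
    · refine pr_congr_ae ?_
      filter_upwards [hw.ae_eq_iff, hf.ae_eq_iff, hv.ae_eq_iff, hvb.ae_eq_iff] with ω h1 h2 h3 h4
      simp only [Prod.mk.injEq, h1, h2, h3, h4]
  have hindep' c : pr μ (fun ω => (v (V ω), (vb (Vb ω), w (W ω)))) (1, (1, c)) *
      pr μ (fun ω => w (W ω)) c = pr μ (fun ω => (v (V ω), w (W ω))) (1, c) *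
        pr μ (fun ω => (vb (Vb ω), w (W ω))) (1, c) := by
    have h1 := pr_mul_pr_of_cmi_eq_zero hVm hVbm hWm hindep (t 1) (u 1) (r c)
    rw [← hv.pr_prod hw, ← hvb.pr_prod hw] at h1
    convert h1 using 2 <;>
    · refine pr_congr_ae ?_
      filter_upwards [hw.ae_eq_iff, hv.ae_eq_iff, hvb.ae_eq_iff] with ω h1 h2 h3
      simp only [Prod.mk.injEq, h1, h2, h3]
  rcases ae_eq_mul_or_ae_eq_mul ((measurable_of_countable w).comp hWm)
    ((measurable_of_countable f).comp hFm) ((measurable_of_countable v).comp hVm)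
    ((measurable_of_countable vb).comp hVbm) (fun a b => (hw.pr_prod hf a b).trans (hWF' a b))
    hFV hFVb hdep' hindep' with h | h
  · exact ⟨w, hw.injOn, h⟩
  · refine ⟨fun z => 1 - w z, fun x hx y hy hxy => hw.injOn hx hy (sub_right_injective hxy), ?_⟩
    filter_upwards [h] with ω hω
    rwa [sub_sub_cancel]

end Flip

/-- under the SW hypotheses, up to injective relabeling into {0,1} we have,
almost surely, Vᵢ = (1 − Wᵢ)·F and V̄ᵢ = Wᵢ·F for all i. -/
theorem stmt_4 {Ω : Type*} [MeasurableSpace Ω] (μ : Measure Ω) [IsProbabilityMeasure μ]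
    (k : ℕ) (hk : 1 ≤ k)
    {SW SV SVb : Fin k → Type*} {SF SG : Type*}
    [∀ i, Fintype (SW i)] [∀ i, Fintype (SV i)] [∀ i, Fintype (SVb i)]
    [Fintype SF] [Fintype SG]
    [∀ i, MeasurableSpace (SW i)] [∀ i, MeasurableSingletonClass (SW i)]
    [∀ i, MeasurableSpace (SV i)] [∀ i, MeasurableSingletonClass (SV i)]
    [∀ i, MeasurableSpace (SVb i)] [∀ i, MeasurableSingletonClass (SVb i)]
    [MeasurableSpace SF] [MeasurableSingletonClass SF]
    [MeasurableSpace SG] [MeasurableSingletonClass SG]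
    (W : (i : Fin k) → Ω → SW i) (V : (i : Fin k) → Ω → SV i) (Vb : (i : Fin k) → Ω → SVb i)
    (F : Ω → SF) (G : Ω → SG)
    (hWm : ∀ i, Measurable (W i)) (hVm : ∀ i, Measurable (V i))
    (hVbm : ∀ i, Measurable (Vb i)) (hFm : Measurable F) (hGm : Measurable G)
    (hWFG : mi μ (fun ω => fun i => W i ω) (fun ω => (F ω, G ω)) = 0)
    (hWunif : ∀ i, UniformOn μ (W i) 2)
    (hdep : ∀ i, condEnt μ (fun ω => (V i ω, Vb i ω)) (fun ω => (W i ω, F ω)) = 0)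
    (hindep : ∀ i, cmi μ (V i) (Vb i) (W i) = 0)
    (hflipV : ∀ i, FlipDist μ F G (V i))
    (hflipVb : ∀ i, FlipDist μ F G (Vb i)) :
    ∃ (f : SF → Fin 2) (wmap : (i : Fin k) → SW i → Fin 2)
      (vmap : (i : Fin k) → SV i → Fin 2) (vbmap : (i : Fin k) → SVb i → Fin 2),
      Set.InjOn f (support μ F) ∧
      (∀ i, Set.InjOn (wmap i) (support μ (W i))) ∧
      (∀ i, Set.InjOn (vmap i) (support μ (V i))) ∧
      (∀ i, Set.InjOn (vbmap i) (support μ (Vb i))) ∧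
      μ {ω | ∀ i, vmap i (V i ω) = (1 - wmap i (W i ω)) * f (F ω) ∧
                  vbmap i (Vb i ω) = wmap i (W i ω) * f (F ω)} = 1 := by
  choose fV sV gV tV v u hfV hgV hv hFG hFV hF using fun i =>
    (hflipV i).exists_labels hFm hGm (hVm i)
  choose fVb sVb gVb tVb vb ub hfVb hgVb hvb hFGb hFVb _ using fun i =>
    (hflipVb i).exists_labels hFm hGm (hVbm i)
  let o : Fin k := ⟨0, hk⟩
  have hind := indepFun_of_mi_eq_zero (measurable_pi_lambda _ hWm) (hFm.prodMk hGm) hWFG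
  have hWF i : IndepFun (W i) F μ := hind.comp (measurable_pi_apply i) measurable_fst
  have hVo i a c : pr μ (fun ω => (fV o (F ω), v i (V i ω))) (a, c) = gatedLaw a c := by
    rw [← hFV i a c]
    refine pr_congr_ae ?_
    filter_upwards [(hfV o).ae_eq_of_driverLaw (hgV o) (hFG o) (hfV i) (hgV i) (hFG i)] with ω h
    rw [h]
  have hVbo i a c : pr μ (fun ω => (fV o (F ω), vb i (Vb i ω))) (a, c) = gatedLaw a c := by
    rw [← hFVb i a c]
    refine pr_congr_ae ?_
    filter_upwards [(hfV o).ae_eq_of_driverLaw (hgV o) (hFG o) (hfVb i) (hgVb i) (hFGb i)] with ω h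
    rw [h]
  choose w hw hae using fun i => (hfV o).exists_eq_mul (hWm i) hFm (hVm i) (hVbm i) (hv i) (hvb i)
    (hF o) (hVo i) (hVbo i) (hWF i) (hWunif i) (hdep i) (hindep i)
  refine ⟨fV o, w, v, vb, (hfV o).injOn, hw, fun i => (hv i).injOn, fun i => (hvb i).injOn, ?_⟩
  rw [← measure_univ (μ := μ)]
  apply measure_congr
  filter_upwards [ae_all_iff.2 hae] with ω hω
  exact eq_true hω

end CIPaper
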